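/- arXiv:2406.19513 — 6 statements merged into one kernel-verified Lean document; each statement's English description precedes it below -/
import Mathlib

section
/- Let H be a real Hilbert space and let (a_i)_{i∈ℕ} and (b_j)_{j∈ℕ} be sequences in the closed unit ball of H. Suppose that for every i the limit c_i = lim_{j→∞} ⟪a_i, b_j⟫ exists and that α = lim_{i→∞} c_i exists, and that for every j the limit d_j = lim_{i→∞} ⟪a_i, b_j⟫ exists and that β = lim_{j→∞} d_j exists. Then α = β. -/
open scoped RealInnerProductSpace

/-- A family in the closed unit ball of a Hilbert space converges weakly along any ultrafilter. -/
lemma exists_tendsto_inner_of_norm_le_one {ι H : Type*} [NormedAddCommGroup H]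
    [InnerProductSpace ℝ H] [CompleteSpace H] (U : Ultrafilter ι) (a : ι → H)
    (ha : ∀ i, ‖a i‖ ≤ 1) :
    ∃ x : H, ∀ v : H, Filter.Tendsto (fun i => ⟪a i, v⟫) U (nhds ⟪x, v⟫) := by
  let f : ι → WeakDual ℝ H := fun i =>
    StrongDual.toWeakDual (InnerProductSpace.toDual ℝ H (a i))
  have hf : ∀ i, f i ∈ WeakDual.toStrongDual ⁻¹'
      Metric.closedBall (0 : StrongDual ℝ H) 1 := fun i => by
    simpa [f] using ha i
  obtain ⟨g, -, hg⟩ := (WeakDual.isCompact_closedBall (𝕜 := ℝ) (E := H) 0 1).ultrafilter_le_nhds'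
    (U.map f) (Filter.mem_map.2 (Filter.univ_mem' hf))
  refine ⟨(InnerProductSpace.toDual ℝ H).symm (WeakDual.toStrongDual g), fun v => ?_⟩
  have h := ((WeakDual.eval_continuous v).tendsto g).comp (show Filter.Tendsto f U (nhds g) from hg)
  rw [InnerProductSpace.toDual_symm_apply]
  exact h

/-- Double-limit (stability) property of the inner product on the closed unit ball of a
real Hilbert space: the two iterated limits of `⟪a i, b j⟫` agree. -/
theorem stmt0 {H : Type*} [NormedAddCommGroup H] [InnerProductSpace ℝ H] [CompleteSpace H]
    (a b : ℕ → H) (ha : ∀ i, ‖a i‖ ≤ 1) (hb : ∀ j, ‖b j‖ ≤ 1)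
    (c d : ℕ → ℝ) (α β : ℝ)
    (hc : ∀ i, Filter.Tendsto (fun j => ⟪a i, b j⟫) Filter.atTop (nhds (c i)))
    (hα : Filter.Tendsto c Filter.atTop (nhds α))
    (hd : ∀ j, Filter.Tendsto (fun i => ⟪a i, b j⟫) Filter.atTop (nhds (d j)))
    (hβ : Filter.Tendsto d Filter.atTop (nhds β)) :
    α = β := by
  have hU : (Filter.hyperfilter ℕ : Filter ℕ) ≤ Filter.atTop := Nat.hyperfilter_le_atTop
  obtain ⟨x, hx⟩ := exists_tendsto_inner_of_norm_le_one (Filter.hyperfilter ℕ) a ha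
  obtain ⟨y, hy⟩ := exists_tendsto_inner_of_norm_le_one (Filter.hyperfilter ℕ) b hb
  have hcy : c = fun i => ⟪a i, y⟫ := funext fun i =>
    tendsto_nhds_unique ((hc i).mono_left hU) (by simpa only [real_inner_comm] using hy (a i))
  have hdx : d = fun j => ⟪x, b j⟫ := funext fun j =>
    tendsto_nhds_unique ((hd j).mono_left hU) (hx (b j))
  have h₁ : α = ⟪x, y⟫ := tendsto_nhds_unique (hα.mono_left hU) (hcy ▸ hx y)
  have h₂ : β = ⟪x, y⟫ := tendsto_nhds_unique (hβ.mono_left hU)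
    (hdx ▸ by simpa only [real_inner_comm] using hy x)
  rw [h₁, h₂]
end

section
/- Let (X,d_X) and (Y,d_Y) be compact metric spaces equipped with Borel probability measures μ and ν of full support. Suppose that for every n ≥ 1, the pushforward of the n-fold product measure μ^⊗n on X^n under the distance-matrix map (x_1,…,x_n) ↦ (d_X(x_i,x_j))_{1≤i,j≤n} ∈ ℝ^{n×n} is equal to the pushforward of ν^⊗n under the corresponding distance-matrix map for (Y,d_Y). Then there exists a bijective isometry e : X → Y such that the pushforward of μ under e equals ν. -/
open MeasureTheory ProbabilityTheory Filter Topology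

/-- A sequence is equidistributed for `μ` if the averages of every continuous function along it
converge to the integral of that function. -/
def IsEquidistributed {X : Type*} [TopologicalSpace X] [MeasurableSpace X] (μ : Measure X)
    (x : ℕ → X) : Prop :=
  ∀ f : C(X, ℝ), Tendsto (fun n : ℕ => (∑ i ∈ Finset.range n, f (x i)) / n) atTop (𝓝 (∫ z, f z ∂μ))

/-- The infinite distance matrix of a sequence. -/
def distMatrix {X : Type*} [Dist X] (x : ℕ → X) (p : ℕ × ℕ) : ℝ :=
  dist (x p.1) (x p.2)

lemma continuous_distMatrix {X : Type*} [PseudoMetricSpace X] :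
    Continuous (distMatrix (X := X)) := by
  unfold distMatrix
  fun_prop

section

variable {X : Type*} [MetricSpace X] [CompactSpace X] [MeasurableSpace X] [BorelSpace X]
  {μ : Measure X} [IsProbabilityMeasure μ]

lemma ae_tendsto_average_infinitePi (f : C(X, ℝ)) :
    ∀ᵐ x ∂(Measure.infinitePi fun _ : ℕ => μ),
      Tendsto (fun n : ℕ => (∑ i ∈ Finset.range n, f (x i)) / n) atTop (𝓝 (∫ z, f z ∂μ)) := by
  have hf : Measurable f := f.continuous.measurable
  have hmp (i : ℕ) : MeasurePreserving (fun x : ℕ → X => x i)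
      (Measure.infinitePi fun _ : ℕ => μ) μ := measurePreserving_eval_infinitePi _ i
  have hint : Integrable f μ :=
    f.continuous.integrable_of_hasCompactSupport (HasCompactSupport.of_compactSpace _)
  have hident (i : ℕ) : IdentDistrib (fun x : ℕ → X => f (x i)) (fun x : ℕ → X => f (x 0))
      (Measure.infinitePi fun _ : ℕ => μ) (Measure.infinitePi fun _ : ℕ => μ) :=
    IdentDistrib.comp (u := f) ⟨(hmp i).aemeasurable, (hmp 0).aemeasurable,
      (hmp i).map_eq.trans (hmp 0).map_eq.symm⟩ hf
  have key := strong_law_ae_real (fun i (x : ℕ → X) => f (x i))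
    ((hmp 0).integrable_comp_of_integrable hint)
    (fun i j hij => (iIndepFun_infinitePi (P := fun _ : ℕ => μ) (X := fun _ => f)
      fun _ => hf).indepFun hij) hident
  have h0 : ∫ x : ℕ → X, f (x 0) ∂(Measure.infinitePi fun _ : ℕ => μ) = ∫ z, f z ∂μ := by
    conv_rhs => rw [← (hmp 0).map_eq]
    exact (integral_map (hmp 0).aemeasurable f.continuous.aestronglyMeasurable).symm
  rwa [h0] at key

lemma isEquidistributed_of_dense {x : ℕ → X} {s : Set C(X, ℝ)} (hs : Dense s)
    (h : ∀ f ∈ s, Tendsto (fun n : ℕ => (∑ i ∈ Finset.range n, f (x i)) / n) atTop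
      (𝓝 (∫ z, f z ∂μ))) :
    IsEquidistributed μ x := by
  intro f
  have hint (f : C(X, ℝ)) : Integrable f μ :=
    f.continuous.integrable_of_hasCompactSupport (HasCompactSupport.of_compactSpace _)
  rw [Metric.tendsto_atTop]
  intro ε hε
  obtain ⟨g, hgs, hg⟩ := Metric.dense_iff.1 hs f (ε / 3) (by positivity) |>.imp fun _ h => h.symm
  rw [Metric.mem_ball, dist_comm] at hg
  have hfg (z : X) : |f z - g z| ≤ ε / 3 := (ContinuousMap.dist_apply_le_dist z).trans hg.le
  obtain ⟨N, hN⟩ := Metric.tendsto_atTop.1 (h g hgs) (ε / 3) (by positivity)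
  refine ⟨N, fun n hn => ?_⟩
  have hI : |∫ z, f z ∂μ - ∫ z, g z ∂μ| ≤ ε / 3 := by
    rw [← integral_sub (hint f) (hint g)]
    simpa using norm_integral_le_of_norm_le_const (μ := μ) (f := fun z => f z - g z)
      (.of_forall hfg)
  have hS : |(∑ i ∈ Finset.range n, f (x i)) / n - (∑ i ∈ Finset.range n, g (x i)) / n|
      ≤ ε / 3 := by
    rw [← sub_div, ← Finset.sum_sub_distrib, abs_div, Nat.abs_cast]
    refine div_le_of_le_mul₀ (by positivity) (by positivity) ?_
    refine (Finset.abs_sum_le_sum_abs _ _).trans ((Finset.sum_le_sum fun i _ => hfg (x i)).trans ?_)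
    simp [mul_comm]
  have hn' := hN n hn
  rw [Real.dist_eq] at hn' ⊢
  rw [abs_lt] at *
  rw [abs_le] at *
  constructor <;> linarith

lemma ae_isEquidistributed_infinitePi :
    ∀ᵐ x ∂(Measure.infinitePi fun _ : ℕ => μ), IsEquidistributed μ x := by
  obtain ⟨s, hsc, hsd⟩ := TopologicalSpace.exists_countable_dense C(X, ℝ)
  filter_upwards [(ae_ball_iff hsc).2 fun f _ => ae_tendsto_average_infinitePi (μ := μ) f]
    with x hx using isEquidistributed_of_dense hsd hx

lemma IsEquidistributed.denseRange [μ.IsOpenPosMeasure] {x : ℕ → X}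
    (hx : IsEquidistributed μ x) : DenseRange x := by
  intro p
  by_contra hp
  let f : C(X, ℝ) := ⟨fun z => Metric.infDist z (Set.range x), Metric.continuous_infDist_pt _⟩
  have hf (i : ℕ) : f (x i) = 0 := Metric.infDist_zero_of_mem (Set.mem_range_self i)
  have hpos : 0 < ∫ z, f z ∂μ :=
    f.continuous.integral_pos_of_hasCompactSupport_nonneg_nonzero
      (HasCompactSupport.of_compactSpace _) (fun _ => Metric.infDist_nonneg) (x := p)
      fun h0 => hp ((Metric.mem_closure_iff_infDist_zero (Set.range_nonempty x)).2 h0)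
  refine hpos.ne (tendsto_nhds_unique ?_ (hx f))
  simp [hf]

lemma exists_isCompact_isEquidistributed :
    ∃ K : Set (ℕ → X), IsCompact K ∧ (∀ x ∈ K, IsEquidistributed μ x) ∧
      1 / 2 < (Measure.infinitePi fun _ : ℕ => μ) K := by
  have h0 : (Measure.infinitePi fun _ : ℕ => μ) {x | ¬ IsEquidistributed μ x} < 1 / 2 := by
    rw [ae_iff.1 ae_isEquidistributed_infinitePi]
    simp
  obtain ⟨U, hU, hUo, hlt⟩ := Set.exists_isOpen_lt_of_lt _ _ h0
  refine ⟨Uᶜ, hUo.isClosed_compl.isCompact, fun x hx => not_not.1 fun h => hx (hU h), ?_⟩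
  rw [prob_compl_eq_one_sub hUo.measurableSet]
  refine lt_tsub_iff_left.2 ?_
  calc _ < (1 / 2 : ENNReal) + 1 / 2 := ENNReal.add_lt_add_right (by simp) hlt
    _ = 1 := ENNReal.add_halves 1

lemma map_distMatrix_map_restrict (n : ℕ) (I : Finset (ℕ × ℕ))
    (hI : ∀ p ∈ I, p.1 < n ∧ p.2 < n) :
    ((Measure.infinitePi fun _ : ℕ => μ).map distMatrix).map I.restrict =
      ((Measure.pi fun _ : Fin n => μ).map
        (fun x : Fin n → X => fun p : Fin n × Fin n => dist (x p.1) (x p.2))).map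
        (fun d (p : I) => d (⟨p.1.1, (hI p p.2).1⟩, ⟨p.1.2, (hI p p.2).2⟩)) := by
  have hpi := Measure.map_infinitePi_infinitePi_of_inj (P := fun _ : ℕ => μ)
    (Fin.val_injective (n := n))
  rw [Measure.infinitePi_eq_pi (μ := fun _ : Fin n => μ)] at hpi
  have hD : Measurable (distMatrix (X := X)) := continuous_distMatrix.measurable
  have hd : Measurable (fun x : Fin n → X => fun p : Fin n × Fin n => dist (x p.1) (x p.2)) :=
    Continuous.measurable (by fun_prop)
  rw [← hpi, Measure.map_map hd (by fun_prop), Measure.map_map (by fun_prop) hD,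
    Measure.map_map (by fun_prop) (hd.comp (by fun_prop))]
  rfl

end

section

variable {X Y : Type*} [MetricSpace X] [MetricSpace Y]

lemma exists_isometryEquiv_of_denseRange [CompleteSpace X] [CompleteSpace Y] {ι : Type*}
    {x : ι → X} {y : ι → Y} (hx : DenseRange x) (hy : DenseRange y)
    (h : ∀ i j, dist (x i) (x j) = dist (y i) (y j)) :
    ∃ e : X ≃ᵢ Y, ∀ i, e (x i) = y i := by
  let _ : PseudoMetricSpace ι := PseudoMetricSpace.induced x inferInstance
  have hix : Isometry x := Isometry.of_dist_eq fun _ _ => rfl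
  have hiy : Isometry y := Isometry.of_dist_eq fun i j => (h i j).symm
  let P : AbstractCompletion ι :=
    ⟨X, x, inferInstance, inferInstance, inferInstance, hix.isUniformInducing, hx⟩
  let Q : AbstractCompletion ι :=
    ⟨Y, y, inferInstance, inferInstance, inferInstance, hiy.isUniformInducing, hy⟩
  let e : X ≃ᵤ Y := P.compareEquiv Q
  have he (i : ι) : e (x i) = y i := P.compare_coe Q i
  refine ⟨⟨e.toEquiv, Isometry.of_dist_eq fun a b => ?_⟩, he⟩
  change dist (e a) (e b) = dist a b
  have hc : Continuous e := e.continuous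
  refine hx.induction_on₂ (p := fun a b => dist (e a) (e b) = dist a b)
    (isClosed_eq (by fun_prop) (by fun_prop)) (fun i j => ?_) a b
  rw [he, he, h]

lemma IsEquidistributed.map_eq [CompactSpace X] [CompactSpace Y] [MeasurableSpace X]
    [BorelSpace X] [MeasurableSpace Y] [BorelSpace Y] {μ : Measure X} {ν : Measure Y}
    [IsFiniteMeasure μ] [IsFiniteMeasure ν] {x : ℕ → X} {e : X → Y} (he : Continuous e)
    (hx : IsEquidistributed μ x) (hy : IsEquidistributed ν (e ∘ x)) : μ.map e = ν := by
  refine ext_of_forall_integral_eq_of_IsFiniteMeasure fun f => ?_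
  rw [integral_map he.aemeasurable f.continuous.aestronglyMeasurable]
  exact tendsto_nhds_unique (hx (f.toContinuousMap.comp ⟨e, he⟩)) (hy f.toContinuousMap)

end

/-- If all finite distance-matrix distributions agree, so do the infinite ones. -/
lemma map_distMatrix_infinitePi_eq {X Y : Type*} [MetricSpace X] [MetricSpace Y]
    [CompactSpace X] [CompactSpace Y]
    [MeasurableSpace X] [BorelSpace X] [MeasurableSpace Y] [BorelSpace Y]
    (μ : Measure X) (ν : Measure Y) [IsProbabilityMeasure μ] [IsProbabilityMeasure ν]
    (h : ∀ n : ℕ, 1 ≤ n →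
      Measure.map (fun x : Fin n → X => fun p : Fin n × Fin n => dist (x p.1) (x p.2))
          (Measure.pi fun _ : Fin n => μ) =
        Measure.map (fun y : Fin n → Y => fun p : Fin n × Fin n => dist (y p.1) (y p.2))
          (Measure.pi fun _ : Fin n => ν)) :
    (Measure.infinitePi fun _ : ℕ => μ).map distMatrix =
      (Measure.infinitePi fun _ : ℕ => ν).map distMatrix := by
  refine IsProjectiveLimit.unique
    (P := fun I => ((Measure.infinitePi fun _ : ℕ => ν).map distMatrix).map I.restrict)
    (fun I => ?_) fun _ => rfl
  let n := I.sup (fun p => max p.1 p.2) + 1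
  have hI : ∀ p ∈ I, p.1 < n ∧ p.2 < n := fun p hp => by
    have := Finset.le_sup (f := fun p : ℕ × ℕ => max p.1 p.2) hp
    simp only [n]
    omega
  change _ = ((Measure.infinitePi fun _ : ℕ => ν).map distMatrix).map I.restrict
  rw [map_distMatrix_map_restrict n I hI, map_distMatrix_map_restrict n I hI, h n (by simp [n])]

/-- Gromov–Vershik reconstruction theorem: two compact metric spaces with fully supported
Borel probability measures whose distance-matrix distributions agree for every `n ≥ 1`
are related by a measure-preserving bijective isometry. -/
theorem stmt1 {X Y : Type*} [MetricSpace X] [MetricSpace Y] [CompactSpace X] [CompactSpace Y]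
    [MeasurableSpace X] [BorelSpace X] [MeasurableSpace Y] [BorelSpace Y]
    (μ : Measure X) (ν : Measure Y) [IsProbabilityMeasure μ] [IsProbabilityMeasure ν]
    [μ.IsOpenPosMeasure] [ν.IsOpenPosMeasure]
    (h : ∀ n : ℕ, 1 ≤ n →
      Measure.map (fun x : Fin n → X => fun p : Fin n × Fin n => dist (x p.1) (x p.2))
          (Measure.pi fun _ : Fin n => μ) =
        Measure.map (fun y : Fin n → Y => fun p : Fin n × Fin n => dist (y p.1) (y p.2))
          (Measure.pi fun _ : Fin n => ν)) :
    ∃ e : X ≃ᵢ Y, Measure.map (⇑e) μ = ν := by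
  have hD := map_distMatrix_infinitePi_eq μ ν h
  obtain ⟨K, hK, hKe, hKm⟩ := exists_isCompact_isEquidistributed (μ := μ)
  obtain ⟨L, hL, hLe, hLm⟩ := exists_isCompact_isEquidistributed (μ := ν)
  have hK' : IsCompact (distMatrix '' K) := hK.image continuous_distMatrix
  have hL' : IsCompact (distMatrix '' L) := hL.image continuous_distMatrix
  have hmX : Measurable (distMatrix (X := X)) := continuous_distMatrix.measurable
  have hmY : Measurable (distMatrix (X := Y)) := continuous_distMatrix.measurable
  obtain ⟨_, ⟨x, hx, rfl⟩, y, hy, hxy⟩ : (distMatrix '' K ∩ distMatrix '' L).Nonempty := by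
    by_contra hne
    have hdisj := Set.disjoint_iff_inter_eq_empty.2 (Set.not_nonempty_iff_eq_empty.1 hne)
    let ρ := (Measure.infinitePi fun _ : ℕ => μ).map distMatrix
    have : IsProbabilityMeasure ρ := Measure.isProbabilityMeasure_map hmX.aemeasurable
    have hρK : 1 / 2 < ρ (distMatrix '' K) := by
      rw [Measure.map_apply hmX hK'.measurableSet]
      exact hKm.trans_le (measure_mono (Set.subset_preimage_image _ _))
    have hρL : 1 / 2 < ρ (distMatrix '' L) := by
      simp only [ρ]
      rw [hD, Measure.map_apply hmY hL'.measurableSet]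
      exact hLm.trans_le (measure_mono (Set.subset_preimage_image _ _))
    have hlt := ENNReal.add_lt_add hρK hρL
    rw [ENNReal.add_halves, ← measure_union hdisj hL'.measurableSet] at hlt
    exact hlt.not_ge prob_le_one
  obtain ⟨e, he⟩ := exists_isometryEquiv_of_denseRange (hKe x hx).denseRange
    (hLe y hy).denseRange fun i j => (congrFun hxy (i, j)).symm
  refine ⟨e, (hKe x hx).map_eq e.continuous ?_⟩
  rw [show e ∘ x = y from funext he]
  exact hLe y hy
end

section
/- Let Ω be a set, R ⊆ Ω × Ω a reflexive symmetric relation, and μ a measure on Ω for which each set R(x) is measurable. Let a ∈ Ω, let η > 0 and κ < ∞, and assume that μ(R(x)) ≥ η for every x ∈ R³(a) and that the outer measure of R⁴(a) is at most κ. Then there exists a finite set F ⊆ R³(a) with |F| ≤ κ/η such that R³(a) ⊆ ⋃_{c∈F} R²(c). -/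
open MeasureTheory
open scoped ENNReal

/-- `relBall R n a` is the ball of radius `n` around `a` in the graph metric of the
relation `R`: `relBall R 0 a = {a}`, `relBall R 1 a = R(a)`, and
`relBall R (n+1) a = ⋃_{b ∈ relBall R n a} R(b)`. -/
def relBall {Ω : Type*} (R : Ω → Ω → Prop) : ℕ → Ω → Set Ω
  | 0, a => {a}
  | n + 1, a => ⋃ b ∈ relBall R n a, {c | R b c}

/-- If finite pairwise disjoint subfamilies of `B` with indices in `S` have bounded size, then
one of them meets every `B x` with `x ∈ S`. -/
theorem exists_finset_pairwiseDisjoint_meets {ι α : Type*} (B : ι → Set α)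
    (hne : ∀ i, (B i).Nonempty) (S : Set ι) (N : ℕ)
    (hN : ∀ F : Finset ι, ↑F ⊆ S → (F : Set ι).PairwiseDisjoint B → F.card ≤ N) :
    ∃ F : Finset ι, ↑F ⊆ S ∧ (F : Set ι).PairwiseDisjoint B ∧
      ∀ x ∈ S, ∃ c ∈ F, (B x ∩ B c).Nonempty := by
  classical
  let A : Set ℕ := {n | ∃ F : Finset ι, ↑F ⊆ S ∧ (F : Set ι).PairwiseDisjoint B ∧ F.card = n}
  have hA : A.Nonempty := ⟨0, ∅, by simp, by simp, rfl⟩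
  have hbdd : BddAbove A := ⟨N, by rintro _ ⟨F, hF, hd, rfl⟩; exact hN F hF hd⟩
  obtain ⟨F, hF, hd, hcard⟩ := Nat.sSup_mem hA hbdd
  refine ⟨F, hF, hd, fun x hx => ?_⟩
  by_contra! hdisj
  have hxF : x ∉ F := fun h => (hne x).ne_empty (by simpa using hdisj x h)
  have hmem : (insert x F).card ∈ A := by
    refine ⟨insert x F, ?_, ?_, rfl⟩
    · rw [Finset.coe_insert]
      exact Set.insert_subset hx hF
    · rw [Finset.coe_insert]
      exact hd.insert fun c hc _ => Set.disjoint_iff_inter_eq_empty.2 (hdisj c hc)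
  have hle := le_csSup hbdd hmem
  rw [Finset.card_insert_of_notMem hxF] at hle
  omega

/-- A finite pairwise disjoint family of measurable sets of measure at least `η` inside a set
`U` has measure at least its size times `η`. -/
theorem card_mul_le_measure_of_pairwiseDisjoint {ι Ω : Type*} [MeasurableSpace Ω]
    (μ : Measure Ω) {B : ι → Set Ω} {U : Set Ω} {η : ℝ≥0∞} (F : Finset ι)
    (hd : (F : Set ι).PairwiseDisjoint B) (hmeas : ∀ i ∈ F, MeasurableSet (B i))
    (hlow : ∀ i ∈ F, η ≤ μ (B i)) (hsub : ∀ i ∈ F, B i ⊆ U) :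
    F.card * η ≤ μ U :=
  calc (F.card : ℝ≥0∞) * η = ∑ _i ∈ F, η := by simp
    _ ≤ ∑ i ∈ F, μ (B i) := Finset.sum_le_sum hlow
    _ = μ (⋃ i ∈ F, B i) := (measure_biUnion_finset hd hmeas).symm
    _ ≤ μ U := measure_mono (Set.iUnion₂_subset hsub)

/-- Ruzsa-type covering lemma for reflexive symmetric relations: if every unit ball
centered in `R³(a)` has measure at least `η` and the (outer) measure of `R⁴(a)` is at
most `κ`, then `R³(a)` is covered by at most `κ/η` balls `R²(c)` with centers in `R³(a)`. -/
theorem stmt2 {Ω : Type*} [MeasurableSpace Ω] (μ : Measure Ω)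
    (R : Ω → Ω → Prop) (hrefl : ∀ x, R x x) (hsymm : ∀ x y, R x y → R y x)
    (hmeas : ∀ x, MeasurableSet {b | R x b})
    (a : Ω) (η κ : ℝ≥0∞) (hη : 0 < η) (hκ : κ < ⊤)
    (hlow : ∀ x ∈ relBall R 3 a, η ≤ μ {b | R x b})
    (hup : μ (relBall R 4 a) ≤ κ) :
    ∃ F : Finset Ω, ↑F ⊆ relBall R 3 a ∧ (F.card : ℝ≥0∞) ≤ κ / η ∧
      relBall R 3 a ⊆ ⋃ c ∈ F, relBall R 2 c := by
  have hcard : ∀ F : Finset Ω, ↑F ⊆ relBall R 3 a →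
      (F : Set Ω).PairwiseDisjoint (fun x => {b | R x b}) → (F.card : ℝ≥0∞) ≤ κ / η := by
    intro F hF hd
    rw [ENNReal.le_div_iff_mul_le (Or.inl hη.ne') (Or.inr hκ.ne)]
    exact (card_mul_le_measure_of_pairwiseDisjoint μ F hd (fun i _ => hmeas i)
      (fun i hi => hlow i (hF hi))
      (fun i hi => Set.subset_biUnion_of_mem (u := fun b => {c | R b c}) (hF hi))).trans hup
  obtain ⟨N, hN⟩ := ENNReal.exists_nat_gt (ENNReal.div_lt_top hκ.ne hη.ne').ne
  obtain ⟨F, hF, hd, hmeet⟩ := exists_finset_pairwiseDisjoint_meets (fun x => {b | R x b})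
    (fun x => ⟨x, hrefl x⟩) (relBall R 3 a) N
    (fun F hF hd => by exact_mod_cast (hcard F hF hd).trans hN.le)
  refine ⟨F, hF, hcard F hF hd, fun x hx => ?_⟩
  obtain ⟨c, hc, z, hxz, hcz⟩ := hmeet x hx
  refine Set.mem_iUnion₂.2 ⟨c, hc, Set.mem_iUnion₂.2 ⟨z, ?_, hsymm x z hxz⟩⟩
  exact Set.mem_iUnion₂.2 ⟨c, rfl, hcz⟩
end

section
/- Let Ω be a set, R ⊆ Ω × Ω a reflexive symmetric relation, and μ a measure on Ω for which each set R(x) and each intersection R(x) ∩ R(y) is measurable. Let η > 0 and assume μ(R(x)) ≥ η for all x ∈ Ω. Let a ∈ Ω and a_1,…,a_k ∈ Ω be such that R²(a) ⊆ ⋃_{i=1}^k R(a_i), and assume that for each i the set {b ∈ R(a) : μ(R(a_i) ∩ R(b)) ≥ η/k} is measurable. Then there exists c ∈ {a_1,…,a_k} such that μ({b ∈ Ω : μ(R(c) ∩ R(b)) ≥ η/k}) ≥ η/k. -/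
open MeasureTheory
open scoped ENNReal

/-- Pigeonhole for measures: if `k` sets cover a set of measure at least `η`, one of them has
measure at least `η / k`. -/
theorem exists_div_le_measure_of_subset_iUnion {Ω : Type*} [MeasurableSpace Ω] {μ : Measure Ω}
    {η : ℝ≥0∞} (hη : 0 < η) {k : ℕ} {s : Set Ω} {t : Fin k → Set Ω}
    (hs : η ≤ μ s) (hst : s ⊆ ⋃ i, t i) : ∃ i, η / k ≤ μ (t i) := by
  by_contra! h
  have hle : η ≤ ∑ i, μ (t i) := hs.trans ((measure_mono hst).trans (measure_iUnion_fintype_le μ t))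
  rcases Nat.eq_zero_or_pos k with rfl | hk
  · simp [hη.ne'] at hle
  · have hlt : ∑ i, μ (t i) < ∑ _i : Fin k, η / k :=
      ENNReal.sum_lt_sum_of_nonempty ⟨⟨0, hk⟩, Finset.mem_univ _⟩ fun i _ => h i
    rw [Finset.sum_const, Finset.card_univ, Fintype.card_fin, nsmul_eq_mul] at hlt
    exact (hle.trans_lt hlt).not_ge ENNReal.mul_div_le

/-- Weak Fubini from doubling: if all unit balls have measure at least `η` and the
`2`-ball around `a` is covered by the `k` unit balls `R(a_1), …, R(a_k)`, then for some
center `c = a_i` the set of points `b` with `μ(R(c) ∩ R(b)) ≥ η/k` has measure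
at least `η/k`. -/
theorem stmt3 {Ω : Type*} [MeasurableSpace Ω] (μ : Measure Ω)
    (R : Ω → Ω → Prop) (hrefl : ∀ x, R x x) (hsymm : ∀ x y, R x y → R y x)
    (hmeas : ∀ x, MeasurableSet {b | R x b})
    (hmeasInter : ∀ x y, MeasurableSet ({b | R x b} ∩ {b | R y b}))
    (η : ℝ≥0∞) (hη : 0 < η) (hlow : ∀ x, η ≤ μ {b | R x b})
    (a : Ω) (k : ℕ) (as : Fin k → Ω)
    (hcover : relBall R 2 a ⊆ ⋃ i, {b | R (as i) b})
    (hmeas2 : ∀ i : Fin k,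
      MeasurableSet {b | R a b ∧ η / k ≤ μ ({y | R (as i) y} ∩ {y | R b y})}) :
    ∃ i : Fin k, η / k ≤ μ {b | η / k ≤ μ ({y | R (as i) y} ∩ {y | R b y})} := by
  have hball : ∀ b, R a b → ∃ i : Fin k, η / k ≤ μ ({y | R (as i) y} ∩ {y | R b y}) := by
    intro b hab
    refine exists_div_le_measure_of_subset_iUnion hη (hlow b) fun y hby => ?_
    have hy : y ∈ relBall R 2 a := by
      simp only [relBall, Set.mem_iUnion, Set.mem_singleton_iff, Set.mem_ofPred_eq]
      exact ⟨b, ⟨a, rfl, hab⟩, hby⟩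
    obtain ⟨i, hi⟩ := Set.mem_iUnion.1 (hcover hy)
    exact Set.mem_iUnion.2 ⟨i, hi, hby⟩
  exact exists_div_le_measure_of_subset_iUnion hη (hlow a) fun b hab =>
    Set.mem_iUnion.2 (hball b hab)
end

section
/- For every integer δ ≥ 1 there exist constants C > 0 and m ∈ ℕ, depending only on δ, with the following property. Let (Ω,μ) be a probability space and (A_b)_{b∈B} a family of measurable subsets of Ω of VC dimension at most δ. Then for every integer n ≥ 2, any b_1,…,b_k ∈ B satisfying μ(A_{b_i} △ A_{b_j}) ≥ 1/n for all i ≠ j must satisfy k ≤ C·n^m. In other words, the pseudometric space (B, d) with d(b,b') = μ(A_b △ A_{b'}) has finite packing dimension, bounded in terms of δ alone. -/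
open MeasureTheory
open scoped ENNReal symmDiff

universe u v

/-- A family of sets `S b ⊆ U`, `b : B`, shatters a finite set `F ⊆ U` if every subset of `F`
is cut out on `F` by some member of the family. -/
def ShattersFam {U B : Type*} (S : B → Set U) (F : Finset U) : Prop :=
  ∀ F' ⊆ F, ∃ b : B, (F : Set U) ∩ S b = (F' : Set U)

/-- The family `S` has VC dimension at most `d`: it shatters no finite set of
cardinality `d + 1`. -/
def VCDimLE {U B : Type*} (S : B → Set U) (d : ℕ) : Prop :=
  ∀ F : Finset U, ShattersFam S F → F.card ≤ d

open Finset in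
/-- Sauer–Shelah bound on the number of traces of a family of VC dimension at most `δ`. -/
theorem VCDimLE.card_le_of_injective_trace {U B : Type*} {S : B → Set U} {δ : ℕ}
    (hS : VCDimLE S δ) (F : Finset U) {k : ℕ} (b : Fin k → B)
    (hinj : ∀ i j, i ≠ j → ∃ x ∈ F, x ∈ S (b i) ∆ S (b j)) :
    k ≤ (F.card + 1) ^ δ := by
  classical
  let tr : Fin k → Finset U := fun i => F.filter (· ∈ S (b i))
  have htr : Function.Injective tr := by
    intro i j hij
    by_contra hne
    obtain ⟨x, hxF, hx⟩ := hinj i j hne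
    have hmem : x ∈ tr i ↔ x ∈ tr j := by rw [hij]
    simp only [tr, mem_filter, hxF, true_and] at hmem
    rw [Set.mem_symmDiff] at hx
    tauto
  let 𝒜 : Finset (Finset U) := univ.image tr
  have hcard : 𝒜.card = k := by simp [𝒜, card_image_of_injective _ htr]
  have hsub : 𝒜.shatterer ⊆ (range (δ + 1)).biUnion fun i => powersetCard i F := by
    intro s hs
    rw [mem_shatterer] at hs
    have hsF : s ⊆ F := by
      obtain ⟨u, hu, hsu⟩ := hs.exists_superset
      obtain ⟨i, -, rfl⟩ := mem_image.1 hu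
      exact hsu.trans (filter_subset _ _)
    have hsδ : s.card ≤ δ := by
      refine hS s fun t ht => ?_
      obtain ⟨u, hu, hsu⟩ := hs ht
      obtain ⟨i, -, rfl⟩ := mem_image.1 hu
      refine ⟨b i, ?_⟩
      rw [← hsu]
      ext x
      have := @hsF x
      simp only [tr, Set.mem_inter_iff, mem_coe, mem_inter, mem_filter]
      tauto
    simp only [mem_biUnion, mem_range, mem_powersetCard]
    exact ⟨s.card, by omega, hsF, rfl⟩
  calc k = 𝒜.card := hcard.symm
    _ ≤ 𝒜.shatterer.card := card_le_card_shatterer 𝒜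
    _ ≤ ((range (δ + 1)).biUnion fun i => powersetCard i F).card := card_le_card hsub
    _ ≤ ∑ i ∈ range (δ + 1), (powersetCard i F).card := card_biUnion_le
    _ ≤ ∑ i ∈ range (δ + 1), F.card ^ i * 1 ^ (δ - i) * δ.choose i := by
        refine sum_le_sum fun i hi => ?_
        rw [card_powersetCard, one_pow, mul_one]
        exact (Nat.choose_le_pow _ _).trans
          (Nat.le_mul_of_pos_right _ (Nat.choose_pos (by simpa [Nat.lt_succ_iff] using hi)))
    _ = (F.card + 1) ^ δ := (add_pow _ _ _).symm

/-- If finitely many measurable sets all have probability at least `ε`, and their number is less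
than `(1 - ε)⁻ᴺ`, then some `N` points meet all of them. -/
theorem exists_sample_hitting {Ω ι : Type*} [MeasurableSpace Ω] (μ : Measure Ω)
    [IsProbabilityMeasure μ] (P : Finset ι) (D : ι → Set Ω) (hD : ∀ p ∈ P, MeasurableSet (D p))
    {ε : ℝ} (hε : ∀ p ∈ P, ε ≤ μ.real (D p)) (N : ℕ) (hN : (P.card : ℝ) * (1 - ε) ^ N < 1) :
    ∃ x : Fin N → Ω, ∀ p ∈ P, ∃ j, x j ∈ D p := by
  by_contra! hcon
  let ν : Measure (Fin N → Ω) := Measure.pi fun _ => μ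
  have hcover : (⋃ p ∈ P, Set.univ.pi fun _ : Fin N => (D p)ᶜ) = Set.univ := by
    refine Set.eq_univ_of_forall fun x => ?_
    obtain ⟨p, hp, hx⟩ := hcon x
    exact Set.mem_biUnion hp fun j _ => hx j
  have hle : (1 : ℝ) ≤ P.card * (1 - ε) ^ N := calc
    (1 : ℝ) = ν.real (⋃ p ∈ P, Set.univ.pi fun _ : Fin N => (D p)ᶜ) := by
        rw [hcover, probReal_univ]
    _ ≤ ∑ p ∈ P, ν.real (Set.univ.pi fun _ : Fin N => (D p)ᶜ) :=
        measureReal_biUnion_finset_le _ _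
    _ ≤ ∑ _p ∈ P, (1 - ε) ^ N := by
        refine Finset.sum_le_sum fun p hp => ?_
        have hpi : ν.real (Set.univ.pi fun _ : Fin N => (D p)ᶜ) = μ.real (D p)ᶜ ^ N := by
          simp [ν, measureReal_def, Measure.pi_pi]
        rw [hpi]
        refine pow_le_pow_left₀ measureReal_nonneg ?_ N
        rw [probReal_compl_eq_one_sub (hD p hp)]
        linarith [hε p hp]
    _ = P.card * (1 - ε) ^ N := by simp
  linarith

theorem one_sub_inv_pow_le_half {n : ℕ} (hn : 1 ≤ n) : (1 - 1 / (n : ℝ)) ^ n ≤ 1 / 2 := by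
  refine (Real.one_sub_div_pow_le_exp_neg (by exact_mod_cast hn)).trans ?_
  rw [Real.exp_neg, one_div]
  gcongr
  linarith [Real.add_one_le_exp (1 : ℝ)]

/-- Polynomials are dominated by powers of two. -/
theorem exists_pow_le_mul_two_pow (m : ℕ) :
    ∃ c : ℝ, 0 < c ∧ ∀ L : ℕ, (L : ℝ) ^ m ≤ c * 2 ^ L := by
  obtain ⟨c, hc⟩ :=
    (tendsto_pow_const_div_const_pow_of_one_lt m (one_lt_two (α := ℝ))).bddAbove_range
  refine ⟨max c 1, by positivity, fun L => ?_⟩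
  rw [← div_le_iff₀ (by positivity)]
  exact (hc ⟨L, rfl⟩).trans (le_max_left _ _)

/-- If the sets are pairwise at distance at least `1 / n`, then their number is at most
polynomial in `n` and in the logarithm of any bound for it. -/
theorem VCDimLE.card_le_of_separated {Ω B : Type*} [MeasurableSpace Ω] (μ : Measure Ω)
    [IsProbabilityMeasure μ] {A : B → Set Ω} (hA : ∀ b, MeasurableSet (A b)) {δ : ℕ}
    (hδ : VCDimLE A δ) {n : ℕ} (hn : 1 ≤ n) {k : ℕ} (b : Fin k → B)
    (hsep : ∀ i j : Fin k, i ≠ j → (1 : ℝ≥0∞) / n ≤ μ (A (b i) ∆ A (b j)))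
    {L : ℕ} (hL : k < 2 ^ L) : k ≤ (n * (2 * L) + 1) ^ δ := by
  classical
  obtain ⟨x, hx⟩ := exists_sample_hitting μ (Finset.univ.offDiag : Finset (Fin k × Fin k))
    (fun p => A (b p.1) ∆ A (b p.2)) (fun p _ => (hA _).symmDiff (hA _)) (ε := 1 / n)
    (fun p hp => by
      have h := ENNReal.toReal_mono (measure_ne_top _ _)
        (hsep p.1 p.2 (Finset.mem_offDiag.1 hp).2.2)
      simpa [measureReal_def] using h)
    (n * (2 * L)) (by
      have hkL : (k : ℝ) < 2 ^ L := by exact_mod_cast hL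
      have hcard : ((Finset.univ.offDiag : Finset (Fin k × Fin k)).card : ℝ) ≤ k * k := by
        rw [Finset.offDiag_card, Finset.card_univ, Fintype.card_fin]
        exact_mod_cast Nat.sub_le _ _
      have hbase : (0 : ℝ) ≤ 1 - 1 / n := by
        rw [sub_nonneg, div_le_one₀ (by exact_mod_cast hn)]
        exact_mod_cast hn
      calc _ ≤ (k * k : ℝ) * (1 / 2) ^ (2 * L) := by
            rw [pow_mul]
            gcongr
            exact one_sub_inv_pow_le_half hn
        _ < (2 ^ L * 2 ^ L) * (1 / 2) ^ (2 * L) := by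
            gcongr
        _ = 1 := by
            rw [← pow_add, ← two_mul, ← mul_pow]
            norm_num)
  refine (hδ.card_le_of_injective_trace (Finset.univ.image x) b fun i j hij => ?_).trans ?_
  · obtain ⟨l, hl⟩ := hx (i, j) (by simpa using hij)
    exact ⟨x l, by simp, hl⟩
  · gcongr
    exact Finset.card_image_le.trans (by simp)

/-- Finite packing dimension for NIP (finite VC dimension) families: for every `δ ≥ 1` there
are `C > 0` and `m` depending only on `δ` such that for any probability space and any family
of measurable sets of VC dimension at most `δ`, and any `n ≥ 2`, any collection of indices
whose sets are pairwise at symmetric-difference distance at least `1/n` has at most `C·n^m`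
members. -/
theorem stmt8 (δ : ℕ) (hδ : 1 ≤ δ) :
    ∃ (C : ℝ) (m : ℕ), 0 < C ∧
      ∀ (Ω : Type u) (B : Type v) [MeasurableSpace Ω] (μ : Measure Ω),
        IsProbabilityMeasure μ →
        ∀ A : B → Set Ω, (∀ b, MeasurableSet (A b)) → VCDimLE A δ →
          ∀ n : ℕ, 2 ≤ n →
            ∀ (k : ℕ) (b : Fin k → B),
              (∀ i j : Fin k, i ≠ j → (1 : ℝ≥0∞) / n ≤ μ (A (b i) ∆ A (b j))) →
              (k : ℝ) ≤ C * (n : ℝ) ^ m := by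
  obtain ⟨c, hc, hpow⟩ := exists_pow_le_mul_two_pow (2 * δ)
  refine ⟨2 * c * 9 ^ δ, 2 * δ, by positivity, ?_⟩
  intro Ω B _ μ _ A hA hVC n hn k b hsep
  rcases Nat.eq_zero_or_pos k with rfl | hk
  · simp only [Nat.cast_zero]
    positivity
  set L := Nat.log 2 k + 1 with hLdef
  have hkL : k < 2 ^ L := Nat.lt_pow_succ_log_self one_lt_two k
  have hLk : (2 : ℝ) ^ L ≤ 2 * k := by
    have h := Nat.pow_log_le_self 2 hk.ne'
    rw [hLdef, pow_succ']
    exact_mod_cast Nat.mul_le_mul_left 2 h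
  have hbound : k ≤ (3 * n * L) ^ δ := by
    refine (hVC.card_le_of_separated μ hA (by omega) b hsep hkL).trans ?_
    gcongr
    have : 1 ≤ n * L := Nat.mul_pos (by omega) (by omega)
    linarith
  have hbound' : (k : ℝ) ≤ (3 * n * L) ^ δ := by exact_mod_cast hbound
  have hk' : (0 : ℝ) < k := by exact_mod_cast hk
  refine le_of_mul_le_mul_right ?_ hk'
  calc (k : ℝ) * k ≤ (3 * n * L) ^ δ * (3 * n * L) ^ δ := by gcongr
    _ = 9 ^ δ * (n : ℝ) ^ (2 * δ) * (L : ℝ) ^ (2 * δ) := by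
        rw [← mul_pow, pow_mul, pow_mul, ← mul_pow, ← mul_pow]
        ring
    _ ≤ 9 ^ δ * (n : ℝ) ^ (2 * δ) * (c * (2 * k)) := by
        gcongr
        exact (hpow L).trans (by gcongr)
    _ = 2 * c * 9 ^ δ * (n : ℝ) ^ (2 * δ) * k := by ring
end

section
/- Let p be a prime, Λ = ℤ·(1,1) ⊆ ℤ_p × ℝ, and G = (ℤ_p × ℝ)/Λ. Then there is no injective group homomorphism from the circle group ℝ/ℤ into G, even as abstract (non-topological) groups. In particular, the short exact sequence 0 → ℤ_p → G → ℝ/ℤ → 0 does not split. -/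
/-- The solenoid `(ℤ_p × ℝ) / ℤ·(1,1)` has no `p`-torsion. -/
theorem eq_zero_of_prime_nsmul_eq_zero (p : ℕ) [Fact p.Prime]
    (g : (ℤ_[p] × ℝ) ⧸ AddSubgroup.zmultiples ((1 : ℤ_[p]), (1 : ℝ)))
    (hg : p • g = 0) : g = 0 := by
  have hp : p ≠ 0 := (Fact.out : p.Prime).ne_zero
  induction g using QuotientAddGroup.induction_on with
  | H z =>
    obtain ⟨x, t⟩ := z
    rw [← QuotientAddGroup.mk_nsmul, QuotientAddGroup.eq_zero_iff,
      AddSubgroup.mem_zmultiples_iff] at hg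
    obtain ⟨n, hn⟩ := hg
    simp only [Prod.smul_mk, Prod.mk.injEq, zsmul_eq_mul, mul_one, nsmul_eq_mul] at hn
    obtain ⟨hx, ht⟩ := hn
    obtain ⟨m, rfl⟩ : (p : ℤ) ∣ n := by
      have h : (p : ℤ_[p]) ^ 1 ∣ (n : ℤ_[p]) := ⟨x, by rw [hx, pow_one]⟩
      simpa using (PadicInt.pow_p_dvd_int_iff 1 n).1 h
    push_cast at hx ht
    rw [QuotientAddGroup.eq_zero_iff, AddSubgroup.mem_zmultiples_iff]
    refine ⟨m, ?_⟩
    rw [Prod.smul_mk, zsmul_one, zsmul_one, mul_left_cancel₀ (Nat.cast_ne_zero.2 hp) hx,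
      mul_left_cancel₀ (Nat.cast_ne_zero.2 hp) ht]

/-- There is no injective (abstract) group homomorphism from the circle group `ℝ/ℤ` into the
group `G = (ℤ_p × ℝ) / ℤ·(1,1)`; in particular the exact sequence
`0 → ℤ_p → G → ℝ/ℤ → 0` does not split. -/
theorem stmt17 (p : ℕ) [Fact p.Prime] :
    ¬ ∃ φ : AddCircle (1 : ℝ) →+
        ((ℤ_[p] × ℝ) ⧸ AddSubgroup.zmultiples ((1 : ℤ_[p]), (1 : ℝ))),
      Function.Injective φ := by
  rintro ⟨φ, hφ⟩
  have hp : p.Prime := Fact.out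
  have hord : addOrderOf (((1 : ℝ) / p : ℝ) : AddCircle (1 : ℝ)) = p :=
    haveI : Fact ((0 : ℝ) < 1) := ⟨one_pos⟩
    AddCircle.addOrderOf_period_div hp.pos
  have hzero : (((1 : ℝ) / p : ℝ) : AddCircle (1 : ℝ)) = 0 := by
    apply (map_eq_zero_iff φ hφ).1
    apply eq_zero_of_prime_nsmul_eq_zero
    rw [← map_nsmul, addOrderOf_dvd_iff_nsmul_eq_zero.1 hord.dvd, map_zero]
  rw [hzero, addOrderOf_zero] at hord
  exact hp.one_lt.ne hord
end
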